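/- arXiv:1101.5001 — 4 statements merged into one kernel-verified Lean document; each statement's English description precedes it below -/
import Mathlib

section
/- Let $h$ be a positive integer. There exists a constant $C > 0$ depending only on $h$ with the following property: for all finite non-empty sets $A$, $B$ in a commutative group and all reals $\alpha > 0$ with $|A| = m$ and $|A+B| \le \alpha m$, one has $|A + hB| \le \tfrac{e}{2h^2}\, \alpha^h\, m^{2-1/h} + C\, \alpha^h\, m^{2 - 2/(h+1)}$ (real powers of $m$). -/
open Pointwise

/-- `iterSum B k` is the `k`-fold iterated sumset `B + ⋯ + B` (`k` times),
with the convention `iterSum B 0 = {0}`. -/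
def iterSum {G : Type*} [AddCommGroup G] [DecidableEq G] (B : Finset G) : ℕ → Finset G
  | 0 => {0}
  | k + 1 => iterSum B k + B

section Sumsets

variable {G : Type*} [AddCommGroup G] [DecidableEq G]

lemma iterSum_mono {B C : Finset G} (hBC : B ⊆ C) (k : ℕ) : iterSum B k ⊆ iterSum C k := by
  induction k with
  | zero => exact subset_rfl
  | succ k ih => exact Finset.add_subset_add ih hBC

lemma iterSum_one (B : Finset G) : iterSum B 1 = B := by
  rw [iterSum, iterSum, Finset.singleton_zero, zero_add]

/-- Plünnecke's inequality in Petridis' form. -/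
lemma exists_subset_card_add_iterSum_le {A : Finset G} (hA : A.Nonempty) (B : Finset G) :
    ∃ U ⊆ A, U.Nonempty ∧ ∀ k : ℕ,
      ((U + iterSum B k).card : ℝ) ≤ ((A + B).card / A.card : ℝ) ^ k * U.card := by
  have hA' : A ∈ A.powerset.erase ∅ := by simp [hA.ne_empty]
  obtain ⟨U, hU, hmin⟩ := Finset.exists_min_image (A.powerset.erase ∅)
    (fun U ↦ ((U + B).card / U.card : ℝ)) ⟨A, hA'⟩
  simp only [Finset.mem_erase, Finset.mem_powerset] at hU
  have hUne : U.Nonempty := Finset.nonempty_iff_ne_empty.2 hU.1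
  have hU0 : (0 : ℝ) < U.card := by exact_mod_cast hUne.card_pos
  have key : ∀ V ⊆ U, (U + B).card * V.card ≤ (V + B).card * U.card := by
    intro V hV
    obtain rfl | hVne := V.eq_empty_or_nonempty
    · simp
    have hV0 : (0 : ℝ) < V.card := by exact_mod_cast hVne.card_pos
    have := hmin V (by simp [hVne.ne_empty, hV.trans hU.2])
    exact_mod_cast (div_le_div_iff₀ hU0 hV0).1 this
  refine ⟨U, hU.2, hUne, fun k ↦ ?_⟩
  have hle : ((U + iterSum B k).card : ℝ) ≤ ((U + B).card / U.card : ℝ) ^ k * U.card := by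
    induction k with
    | zero => simp [iterSum]
    | succ k ih =>
      refine le_of_mul_le_mul_right ?_ hU0
      have hp : ((U + iterSum B (k + 1)).card : ℝ) * U.card
          ≤ (U + B).card * (U + iterSum B k).card := by
        have := Finset.pluennecke_petridis_inequality_add (iterSum B k) key
        rw [add_comm (iterSum B k) U] at this
        rw [iterSum, ← add_assoc]
        exact_mod_cast this
      calc ((U + iterSum B (k + 1)).card : ℝ) * U.card
          ≤ (U + B).card * (U + iterSum B k).card := hp
        _ ≤ (U + B).card * (((U + B).card / U.card : ℝ) ^ k * U.card) := by gcongr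
        _ = ((U + B).card / U.card : ℝ) ^ (k + 1) * U.card * U.card := by
          rw [pow_succ]; field_simp
  exact hle.trans (mul_le_mul_of_nonneg_right
    (pow_le_pow_left₀ (by positivity) (hmin A hA') k) (by positivity))

lemma card_iterSum_le {A : Finset G} (hA : A.Nonempty) (B : Finset G) (k : ℕ) :
    ((iterSum B k).card : ℝ) ≤ ((A + B).card / A.card : ℝ) ^ k * A.card := by
  obtain ⟨U, hUA, hU, h⟩ := exists_subset_card_add_iterSum_le hA B
  have h₁ : ((iterSum B k).card : ℝ) ≤ (U + iterSum B k).card := by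
    exact_mod_cast Finset.card_le_card_add_left hU
  have h₂ : (U.card : ℝ) ≤ A.card := by exact_mod_cast Finset.card_le_card hUA
  refine h₁.trans ((h k).trans ?_)
  gcongr

/-- Ruzsa's version of Plünnecke's inequality for large subsets. -/
lemma exists_large_subset_card_add_iterSum_le (A B : Finset G) (k : ℕ) {t : ℕ} (ht : 0 < t) :
    ∃ X ⊆ A, (A \ X).card < t ∧
      ((X + iterSum B k).card : ℝ) ≤
        ((A + B).card : ℝ) ^ k * ∑ j ∈ Finset.Ioc 0 A.card, (((max t j : ℕ) : ℝ) ^ k)⁻¹ := by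
  induction A using Finset.strongInduction with
  | H A ih =>
  by_cases hAt : A.card < t
  · exact ⟨∅, by simp, by simpa using hAt, by
      rw [Finset.empty_add, Finset.card_empty, Nat.cast_zero]; positivity⟩
  have hA : A.Nonempty := Finset.card_pos.1 (by omega)
  obtain ⟨U, hUA, hU, hUk⟩ := exists_subset_card_add_iterSum_le hA B
  obtain ⟨X, hX, hXt, hXk⟩ := ih (A \ U) (Finset.sdiff_ssubset hUA hU)
  refine ⟨U ∪ X, Finset.union_subset hUA (hX.trans Finset.sdiff_subset), ?_, ?_⟩
  · rwa [← Finset.sup_eq_union, ← sdiff_sdiff_left]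
  have hcard : (A \ U).card + U.card = A.card := Finset.card_sdiff_add_card_eq_card hUA
  have hsub : (((A \ U) + B).card : ℝ) ≤ (A + B).card := by
    exact_mod_cast Finset.card_le_card (Finset.add_subset_add_right Finset.sdiff_subset)
  have hU1 : (U.card : ℝ) * ((A.card : ℝ) ^ k)⁻¹ ≤
      ∑ j ∈ Finset.Ioc (A \ U).card A.card, (((max t j : ℕ) : ℝ) ^ k)⁻¹ := by
    have hc : (Finset.Ioc (A \ U).card A.card).card = U.card := by
      rw [Nat.card_Ioc]; omega
    rw [← hc, ← nsmul_eq_mul]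
    refine Finset.card_nsmul_le_sum _ _ _ fun j hj ↦ ?_
    have hj' : max t j ≤ A.card := max_le (by omega) (Finset.mem_Ioc.1 hj).2
    have h0 : 0 < max t j := by omega
    gcongr
  have hunion : ((U ∪ X + iterSum B k).card : ℝ) ≤
      (U + iterSum B k).card + (X + iterSum B k).card := by
    rw [Finset.union_add]
    exact_mod_cast Finset.card_union_le _ _
  rw [← Finset.sum_Ioc_consecutive _ (Nat.zero_le (A \ U).card) (by omega), mul_add]
  calc ((U ∪ X + iterSum B k).card : ℝ)
      ≤ (U + iterSum B k).card + (X + iterSum B k).card := hunion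
    _ ≤ ((A + B).card : ℝ) ^ k * (U.card * ((A.card : ℝ) ^ k)⁻¹) +
        (((A \ U) + B).card : ℝ) ^ k *
          ∑ j ∈ Finset.Ioc 0 (A \ U).card, (((max t j : ℕ) : ℝ) ^ k)⁻¹ := by
      refine add_le_add ((hUk k).trans_eq ?_) hXk
      rw [div_pow]; ring
    _ ≤ _ := by
      rw [add_comm]
      gcongr

lemma sum_inv_max_pow_le {t n k : ℕ} (ht : 0 < t) (hk : 2 ≤ k) :
    ∑ j ∈ Finset.Ioc 0 n, (((max t j : ℕ) : ℝ) ^ k)⁻¹ ≤ 3 * ((t : ℝ) ^ (k - 1))⁻¹ := by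
  have ht0 : (0 : ℝ) < t := by exact_mod_cast ht
  have hterm : ∀ j : ℕ, (((max t j : ℕ) : ℝ) ^ k)⁻¹ ≤
      ((t : ℝ) ^ (k - 2))⁻¹ * (((max t j : ℕ) : ℝ) ^ 2)⁻¹ := by
    intro j
    have hle : (t : ℝ) ≤ (max t j : ℕ) := by exact_mod_cast le_max_left t j
    have hpos : (0 : ℝ) < (max t j : ℕ) := ht0.trans_le hle
    rw [← mul_inv]
    gcongr
    calc (t : ℝ) ^ (k - 2) * ((max t j : ℕ) : ℝ) ^ 2
        ≤ ((max t j : ℕ) : ℝ) ^ (k - 2) * ((max t j : ℕ) : ℝ) ^ 2 := by gcongr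
      _ = _ := by rw [← pow_add]; congr 1; omega
  have hsq : ∑ j ∈ Finset.Ioc 0 n, (((max t j : ℕ) : ℝ) ^ 2)⁻¹ ≤ 3 * (t : ℝ)⁻¹ := by
    have hsub : Finset.Ioc 0 n ⊆ Finset.Ioc 0 t ∪ Finset.Ioo t (n + 1) := by
      intro j hj
      simp only [Finset.mem_Ioc, Finset.mem_union, Finset.mem_Ioo] at hj ⊢
      omega
    have hdisj : Disjoint (Finset.Ioc 0 t) (Finset.Ioo t (n + 1)) := by
      rw [Finset.disjoint_left]
      intro j hj
      simp only [Finset.mem_Ioc, Finset.mem_Ioo] at hj ⊢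
      omega
    have h1 : ∑ j ∈ Finset.Ioc 0 t, (((max t j : ℕ) : ℝ) ^ 2)⁻¹ = (t : ℝ)⁻¹ := by
      rw [Finset.sum_congr rfl (g := fun _ ↦ ((t : ℝ) ^ 2)⁻¹)]
      · rw [Finset.sum_const, Nat.card_Ioc, nsmul_eq_mul]
        simp only [Nat.sub_zero]
        field_simp
      · intro j hj
        rw [max_eq_left (Finset.mem_Ioc.1 hj).2]
    have h2 : ∑ j ∈ Finset.Ioo t (n + 1), (((max t j : ℕ) : ℝ) ^ 2)⁻¹ ≤ 2 * (t : ℝ)⁻¹ := by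
      rw [Finset.sum_congr rfl (g := fun j : ℕ ↦ ((j : ℝ) ^ 2)⁻¹)]
      · refine (sum_Ioo_inv_sq_le t (n + 1)).trans ?_
        rw [← div_eq_mul_inv]
        gcongr
        linarith
      · intro j hj
        rw [max_eq_right (Finset.mem_Ioo.1 hj).1.le]
    calc _ ≤ ∑ j ∈ Finset.Ioc 0 t ∪ Finset.Ioo t (n + 1), (((max t j : ℕ) : ℝ) ^ 2)⁻¹ :=
          Finset.sum_le_sum_of_subset_of_nonneg hsub fun _ _ _ ↦ by positivity
      _ ≤ _ := by rw [Finset.sum_union hdisj, h1]; linarith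
  calc _ ≤ ∑ j ∈ Finset.Ioc 0 n, ((t : ℝ) ^ (k - 2))⁻¹ * (((max t j : ℕ) : ℝ) ^ 2)⁻¹ :=
        Finset.sum_le_sum fun j _ ↦ hterm j
    _ ≤ ((t : ℝ) ^ (k - 2))⁻¹ * (3 * (t : ℝ)⁻¹) := by
      rw [← Finset.mul_sum]; gcongr
    _ = _ := by
      rw [show k - 1 = k - 2 + 1 by omega, pow_succ, mul_inv]; ring

lemma card_iterSum_mul_factorial_le (B : Finset G) {k : ℕ} (hk : 0 < k) :
    (iterSum B k).card * k.factorial ≤ (B.card + (k - 1)) ^ k := by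
  have hsub : iterSum B k ⊆ Finset.univ.image
      (fun s : Sym B k ↦ (s.1.map Subtype.val).sum) := by
    clear hk
    induction k with
    | zero =>
      intro y hy
      exact Finset.mem_image.2 ⟨Sym.nil, Finset.mem_univ _, by simpa [iterSum, eq_comm] using hy⟩
    | succ k ih =>
      intro y hy
      obtain ⟨a, ha, b, hb, rfl⟩ := Finset.mem_add.1 hy
      obtain ⟨s, -, rfl⟩ := Finset.mem_image.1 (ih ha)
      refine Finset.mem_image.2 ⟨⟨b, hb⟩ ::ₛ s, Finset.mem_univ _, ?_⟩
      change (Multiset.map _ (_ ::ₘ s.1)).sum = _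
      rw [Multiset.map_cons, Multiset.sum_cons, add_comm]
  have hcard := (Finset.card_le_card hsub).trans Finset.card_image_le
  rw [Finset.card_univ, Sym.card_sym_eq_choose, Fintype.card_coe] at hcard
  refine (Nat.mul_le_mul_right _ hcard).trans ?_
  rw [mul_comm, ← Nat.ascFactorial_eq_factorial_mul_choose']
  rcases Nat.eq_zero_or_pos B.card with h0 | h0
  · rw [h0]
    obtain ⟨k, rfl⟩ := Nat.exists_eq_succ_of_ne_zero hk.ne'
    rw [Nat.zero_ascFactorial]; exact Nat.zero_le _
  · obtain ⟨n, hn⟩ := Nat.exists_eq_succ_of_ne_zero h0.ne'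
    rw [hn]
    refine (Nat.ascFactorial_le_pow_add n k).trans (Nat.pow_le_pow_left (by omega) _)

lemma singleton_add_iterSum_subset (X B : Finset G) (x : G) (k : ℕ) :
    {x} + iterSum B k ⊆
      ({x} + iterSum (B.filter fun b ↦ x + b ∉ X + B) k) ∪ (X + iterSum B k) := by
  induction k with
  | zero => simp [iterSum]
  | succ k ih =>
    intro y hy
    rw [iterSum, ← add_assoc] at hy
    obtain ⟨z, hz, b, hb, rfl⟩ := Finset.mem_add.1 hy
    rcases Finset.mem_union.1 (ih hz) with hz | hz
    · by_cases hxb : x + b ∈ X + B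
      · refine Finset.mem_union_right _ ?_
        obtain ⟨x', hx', w, hw, rfl⟩ := Finset.mem_add.1 hz
        obtain ⟨a, ha, c, hc, hac⟩ := Finset.mem_add.1 hxb
        rw [Finset.mem_singleton] at hx'
        subst hx'
        have : x' + w + b = a + (w + c) := by
          rw [add_right_comm, ← hac]; abel
        rw [this]
        exact Finset.add_mem_add ha
          (Finset.add_mem_add (iterSum_mono (Finset.filter_subset _ _) k hw) hc)
      · refine Finset.mem_union_left _ ?_
        rw [iterSum, ← add_assoc]
        exact Finset.add_mem_add hz (Finset.mem_filter.2 ⟨hb, hxb⟩)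
    · refine Finset.mem_union_right _ ?_
      rw [iterSum, ← add_assoc]
      exact Finset.add_mem_add hz hb

lemma card_filter_add_card_le (X B : Finset G) (x : G) :
    (B.filter fun b ↦ x + b ∉ X + B).card + (X + B).card ≤ (insert x X + B).card := by
  have hdisj : Disjoint ((B.filter fun b ↦ x + b ∉ X + B).image (x + ·)) (X + B) := by
    rw [Finset.disjoint_left]
    intro y hy
    obtain ⟨b, hb, rfl⟩ := Finset.mem_image.1 hy
    exact (Finset.mem_filter.1 hb).2
  rw [← Finset.card_image_of_injective _ (add_right_injective x),
    ← Finset.card_union_of_disjoint hdisj]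
  refine Finset.card_le_card (Finset.union_subset ?_
    (Finset.add_subset_add_right (Finset.subset_insert _ _)))
  intro y hy
  obtain ⟨b, hb, rfl⟩ := Finset.mem_image.1 hy
  exact Finset.add_mem_add (Finset.mem_insert_self _ _) (Finset.mem_filter.1 hb).1

lemma le_mul_rpow_of_mul_factorial_le {c n H : ℝ} {k : ℕ} (hk : 0 < k) (hc : 0 ≤ c)
    (hn : 0 ≤ n) (hcn : c * k.factorial ≤ n ^ k) (hcH : c ≤ H) :
    c ≤ Real.exp 1 / k * n * H ^ (1 - 1 / (k : ℝ)) := by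
  have hk1 : (1 : ℝ) ≤ k := by exact_mod_cast hk
  have hexp : c ≤ (Real.exp 1 / k * n) ^ k := by
    have h1 := Real.pow_div_factorial_le_exp (x := (k : ℝ)) (by positivity) k
    rw [div_le_iff₀ (by positivity)] at h1
    rw [mul_pow, div_pow, ← Real.exp_nat_mul, mul_one, div_mul_eq_mul_div,
      le_div_iff₀ (by positivity)]
    calc c * (k : ℝ) ^ k ≤ c * (Real.exp k * k.factorial) := by gcongr
      _ = Real.exp k * (c * k.factorial) := by ring
      _ ≤ _ := by gcongr
  have hroot : c ^ (1 / (k : ℝ)) ≤ Real.exp 1 / k * n := by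
    calc c ^ (1 / (k : ℝ)) ≤ ((Real.exp 1 / k * n) ^ k) ^ (1 / (k : ℝ)) := by gcongr
      _ = _ := by rw [one_div, Real.pow_rpow_inv_natCast (by positivity) hk.ne']
  have hnonneg : 0 ≤ 1 - 1 / (k : ℝ) := by
    rw [sub_nonneg, div_le_one (by positivity)]; exact hk1
  calc c = c ^ (1 / (k : ℝ)) * c ^ (1 - 1 / (k : ℝ)) := by
        rcases hc.eq_or_lt with h0 | h0
        · rw [← h0, Real.zero_rpow (by positivity), zero_mul]
        · rw [← Real.rpow_add h0]; simp
    _ ≤ _ := by gcongr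

lemma card_union_add_iterSum_le (X S B : Finset G) {k : ℕ} (hk : 0 < k) :
    ((X ∪ S + iterSum B k).card : ℝ) ≤ (X + iterSum B k).card +
      Real.exp 1 / k * (((X ∪ S + B).card - (X + B).card) + (k - 1) * S.card) *
        ((iterSum B k).card : ℝ) ^ (1 - 1 / (k : ℝ)) := by
  induction S using Finset.induction_on with
  | empty => simp
  | insert x S hx ih =>
    set Y := X ∪ S
    set N := B.filter fun b ↦ x + b ∉ Y + B
    have h1 : (insert x Y + iterSum B k).card ≤ (iterSum N k).card + (Y + iterSum B k).card := by
      rw [← Finset.card_singleton_add x (iterSum N k)]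
      refine le_trans (Finset.card_le_card ?_) (Finset.card_union_le _ _)
      rw [Finset.insert_eq, Finset.union_add]
      exact Finset.union_subset (singleton_add_iterSum_subset Y B x k) Finset.subset_union_right
    have h2 := card_filter_add_card_le Y B x
    have h3 : ((iterSum N k).card : ℝ) * k.factorial ≤ ((N.card : ℝ) + (k - 1)) ^ k := by
      have := card_iterSum_mul_factorial_le N hk
      have hk' : ((k - 1 : ℕ) : ℝ) = k - 1 := by push_cast [hk]; simp
      rw [← hk']
      exact_mod_cast this
    have hk1 : (1 : ℝ) ≤ k := by exact_mod_cast hk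
    have h4 := le_mul_rpow_of_mul_factorial_le (H := (iterSum B k).card) hk (by positivity)
      (add_nonneg (Nat.cast_nonneg _) (by linarith)) h3
      (by exact_mod_cast Finset.card_le_card (iterSum_mono (Finset.filter_subset _ _) k))
    rw [Finset.union_insert, Finset.card_insert_of_notMem hx]
    have h1' : ((insert x Y + iterSum B k).card : ℝ) ≤
        (iterSum N k).card + (Y + iterSum B k).card := by exact_mod_cast h1
    have h2' : (N.card : ℝ) ≤ (insert x Y + B).card - (Y + B).card := by
      rw [le_sub_iff_add_le]; exact_mod_cast h2
    have h5 : Real.exp 1 / k * ((N.card : ℝ) + (k - 1)) *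
        ((iterSum B k).card : ℝ) ^ (1 - 1 / (k : ℝ)) ≤
        Real.exp 1 / k * (((insert x Y + B).card - (Y + B).card : ℝ) + (k - 1)) *
        ((iterSum B k).card : ℝ) ^ (1 - 1 / (k : ℝ)) := by gcongr
    push_cast
    linarith

end Sumsets

section RealEstimates

lemma two_mul_mul_sub_mul_pow_le {N y : ℝ} {k : ℕ} (hk : 2 ≤ k) (hy : 0 ≤ y) (hyN : y ≤ N) :
    2 * k * ((N - y) * y ^ (k - 1)) ≤ N ^ k := by
  obtain ⟨n, rfl⟩ : ∃ n, k = n + 1 := ⟨k - 1, by omega⟩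
  have hn : 1 ≤ n := by omega
  have hn0 : (0 : ℝ) < n := by exact_mod_cast hn
  rcases hy.eq_or_lt with rfl | hy0
  · rw [Nat.add_sub_cancel, zero_pow (by omega), mul_zero, mul_zero]
    positivity
  have htwo : 2 * (n : ℝ) ^ n ≤ (n + 1) ^ n := by
    have hb := one_add_mul_le_pow (a := (1 / n : ℝ)) (by linarith [one_div_pos.2 hn0]) n
    rw [mul_one_div_cancel hn0.ne'] at hb
    calc 2 * (n : ℝ) ^ n = (1 + 1) * (n : ℝ) ^ n := by norm_num
      _ ≤ (1 + 1 / n) ^ n * (n : ℝ) ^ n := by gcongr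
      _ = _ := by rw [← mul_pow]; congr 1; field_simp
  have hamgm : (N - y) * y ^ n * (n + 1) ^ (n + 1) ≤ N ^ (n + 1) * (n : ℝ) ^ n := by
    set a : ℝ := (n * (N - y) / y - 1) / (n + 1) with ha
    have hd : 0 ≤ n * (N - y) / y := div_nonneg (mul_nonneg hn0.le (sub_nonneg.2 hyN)) hy
    have ha2 : -2 ≤ a := by
      rw [ha, le_div_iff₀ (by positivity)]; linarith
    have hb := one_add_mul_le_pow ha2 (n + 1)
    have h1 : 1 + ((n + 1 : ℕ) : ℝ) * a = n * (N - y) / y := by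
      rw [ha]; push_cast; field_simp; ring
    have h2 : 1 + a = n * N / (y * (n + 1)) := by
      rw [ha]; field_simp; ring
    rw [h1, h2, div_pow, mul_pow, mul_pow, div_le_div_iff₀ hy0 (by positivity)] at hb
    have hb' : ((N - y) * y ^ n * (n + 1) ^ (n + 1)) * (n * y) ≤
        (N ^ (n + 1) * (n : ℝ) ^ n) * (n * y) := by
      calc _ = n * (N - y) * (y ^ (n + 1) * (n + 1) ^ (n + 1)) := by ring
        _ ≤ _ := hb
        _ = _ := by ring
    exact le_of_mul_le_mul_right hb' (by positivity)
  rw [Nat.add_sub_cancel]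
  push_cast
  refine le_of_mul_le_mul_right ?_ (by positivity : (0 : ℝ) < (n + 1) ^ n)
  have hN : 0 ≤ N := hy.trans hyN
  calc 2 * ((n : ℝ) + 1) * ((N - y) * y ^ n) * (n + 1) ^ n
      = 2 * ((N - y) * y ^ n * (n + 1) ^ (n + 1)) := by ring
    _ ≤ 2 * (N ^ (n + 1) * (n : ℝ) ^ n) := by gcongr
    _ = N ^ (n + 1) * (2 * (n : ℝ) ^ n) := by ring
    _ ≤ _ := by gcongr

lemma one_add_pow_le_one_add_two_pow_mul {z : ℝ} (hz : 0 ≤ z) (hz1 : z ≤ 1) (n : ℕ) :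
    (1 + z) ^ n ≤ 1 + 2 ^ n * z := by
  suffices (1 + z) ^ n ≤ 1 + (2 ^ n - 1) * z by linarith
  induction n with
  | zero => simp
  | succ n ih =>
    have h2 : (1 : ℝ) ≤ 2 ^ n := one_le_pow₀ (by norm_num)
    rw [pow_succ, pow_succ]
    nlinarith [mul_le_mul_of_nonneg_right ih (by linarith : 0 ≤ 1 + z),
      mul_nonneg (mul_nonneg (sub_nonneg.2 h2) hz) (sub_nonneg.2 hz1)]

/-- The growth of the part of the sumset coming from few exceptional elements. -/
lemma exceptional_part_le {M α y s H : ℝ} {k : ℕ} (hk : 2 ≤ k) (hM : 1 ≤ M) (hα : 1 ≤ α)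
    (hy : 0 ≤ y) (hyN : y ≤ α * M) (hs : 0 ≤ s) (hsM : 2 * s ≤ M ^ ((k : ℝ) / (k + 1)))
    (hH : 0 ≤ H) (hHy : H ≤ (y / (M - s)) ^ k * (M - s)) :
    Real.exp 1 / k * ((α * M - y) + (k - 1) * s) * H ^ (1 - 1 / (k : ℝ)) ≤
      Real.exp 1 / (2 * (k : ℝ) ^ 2) * α ^ k * M ^ (2 - 1 / (k : ℝ)) +
        2 * Real.exp 1 * 2 ^ k * α ^ k * M ^ (2 - 2 / ((k : ℝ) + 1)) := by
  have hM0 : 0 < M := by linarith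
  have hk2 : (2 : ℝ) ≤ k := by exact_mod_cast hk
  have hk0 : (0 : ℝ) < k := by linarith
  set z : ℝ := M ^ (-(1 / ((k : ℝ) + 1))) with hz
  have hz0 : 0 ≤ z := by positivity
  have hz1 : z ≤ 1 := Real.rpow_le_one_of_one_le_of_nonpos hM (by
    rw [neg_nonpos]; positivity)
  have hMz : M ^ ((k : ℝ) / (k + 1)) = M * z := by
    rw [hz]
    nth_rewrite 2 [← Real.rpow_one M]
    rw [← Real.rpow_add hM0]
    congr 1
    field_simp
    ring
  rw [hMz] at hsM
  have hMz' : M * z ≤ M := mul_le_of_le_one_right hM0.le hz1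
  have hr0 : 0 < M - s := by linarith
  have hexp0 : 0 ≤ 1 - 1 / (k : ℝ) := by
    rw [sub_nonneg, div_le_one hk0]; linarith
  have hHpow : H ^ (1 - 1 / (k : ℝ)) ≤ (y / (M - s)) ^ (k - 1) * M ^ (1 - 1 / (k : ℝ)) := by
    calc H ^ (1 - 1 / (k : ℝ))
        ≤ ((y / (M - s)) ^ k * (M - s)) ^ (1 - 1 / (k : ℝ)) := by gcongr
      _ = (y / (M - s)) ^ (k - 1) * (M - s) ^ (1 - 1 / (k : ℝ)) := by
        rw [Real.mul_rpow (by positivity) hr0.le, ← Real.rpow_natCast,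
          ← Real.rpow_mul (by positivity), ← Real.rpow_natCast]
        congr 2
        rw [Nat.cast_sub (by omega)]
        field_simp
        simp
      _ ≤ _ := by gcongr; linarith
  have hratio : M / (M - s) ≤ 1 + z := by
    rw [div_le_iff₀ hr0]; nlinarith
  have hratio' : (M / (M - s)) ^ (k - 1) ≤ 1 + 2 ^ k * z := by
    calc (M / (M - s)) ^ (k - 1) ≤ (1 + z) ^ (k - 1) := by gcongr
      _ ≤ 1 + 2 ^ (k - 1) * z := one_add_pow_le_one_add_two_pow_mul hz0 hz1 _
      _ ≤ _ := by gcongr; norm_num; omega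
  have hone : 1 + z ≤ 2 := by linarith
  have hratio2 : (M / (M - s)) ^ (k - 1) ≤ 2 ^ k := by
    calc (M / (M - s)) ^ (k - 1) ≤ 2 ^ (k - 1) := by gcongr; exact hratio.trans hone
      _ ≤ _ := by gcongr; norm_num; omega
  have hpowM : M * M ^ (1 - 1 / (k : ℝ)) = M ^ (2 - 1 / (k : ℝ)) := by
    nth_rewrite 1 [← Real.rpow_one M]
    rw [← Real.rpow_add hM0]
    congr 1
    ring
  have hpowz : M ^ (2 - 1 / (k : ℝ)) * z ≤ M ^ (2 - 2 / ((k : ℝ) + 1)) := by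
    rw [hz, ← Real.rpow_add hM0]
    refine Real.rpow_le_rpow_of_exponent_le hM ?_
    have : 1 / ((k : ℝ) + 1) ≤ 1 / k := by gcongr; linarith
    have h2 : 2 / ((k : ℝ) + 1) = 1 / ((k : ℝ) + 1) + 1 / ((k : ℝ) + 1) := by ring
    linarith
  set E := Real.exp 1
  have hE : 0 < E := Real.exp_pos 1
  set D := M ^ (2 - 1 / (k : ℝ))
  set F := M ^ (2 - 2 / ((k : ℝ) + 1))
  have hD0 : 0 ≤ D := by positivity
  have hF0 : 0 ≤ F := by positivity
  have hMk : M ^ k = M * M ^ (k - 1) := by rw [← pow_succ']; congr 1; omega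
  have hαk : α ^ (k - 1) ≤ α ^ k := pow_le_pow_right₀ hα (by omega)
  have hmain : E / k * (α * M - y) * ((y / (M - s)) ^ (k - 1) * M ^ (1 - 1 / (k : ℝ))) ≤
      E / (2 * (k : ℝ) ^ 2) * α ^ k * D + E * 2 ^ k * α ^ k * F := by
    have h1 : (α * M - y) * y ^ (k - 1) ≤ (α * M) ^ k / (2 * k) := by
      rw [le_div_iff₀ (by positivity), mul_comm]
      exact two_mul_mul_sub_mul_pow_le hk hy hyN
    have hcoef : E / (2 * (k : ℝ) ^ 2) ≤ E := div_le_self hE.le (by nlinarith)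
    calc E / k * (α * M - y) * ((y / (M - s)) ^ (k - 1) * M ^ (1 - 1 / (k : ℝ)))
        = E / k * ((α * M - y) * y ^ (k - 1)) * (M ^ (1 - 1 / (k : ℝ)) / (M - s) ^ (k - 1)) := by
          rw [div_pow]; ring
      _ ≤ E / k * ((α * M) ^ k / (2 * k)) * (M ^ (1 - 1 / (k : ℝ)) / (M - s) ^ (k - 1)) := by
          gcongr
      _ = E / (2 * (k : ℝ) ^ 2) * α ^ k * D * (M / (M - s)) ^ (k - 1) := by
          rw [← hpowM, mul_pow, hMk, div_pow]; field_simp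
      _ ≤ E / (2 * (k : ℝ) ^ 2) * α ^ k * D * (1 + 2 ^ k * z) := by gcongr
      _ = E / (2 * (k : ℝ) ^ 2) * α ^ k * D +
          E / (2 * (k : ℝ) ^ 2) * 2 ^ k * α ^ k * (D * z) := by ring
      _ ≤ _ := by gcongr
  have hrest : E / k * ((k - 1) * s) * ((y / (M - s)) ^ (k - 1) * M ^ (1 - 1 / (k : ℝ))) ≤
      E * 2 ^ k * α ^ k * F := by
    have h1 : E / k * (k - 1) ≤ E := by
      rw [div_mul_eq_mul_div, div_le_iff₀ hk0]; nlinarith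
    have h2 : (y / (M - s)) ^ (k - 1) ≤ α ^ k * 2 ^ k := by
      calc (y / (M - s)) ^ (k - 1) ≤ (α * M / (M - s)) ^ (k - 1) := by gcongr
        _ = α ^ (k - 1) * (M / (M - s)) ^ (k - 1) := by rw [mul_div_assoc, mul_pow]
        _ ≤ _ := by gcongr
    have h3 : s ≤ M * z := by linarith
    calc E / k * ((k - 1) * s) * ((y / (M - s)) ^ (k - 1) * M ^ (1 - 1 / (k : ℝ)))
        = (E / k * (k - 1)) * s * ((y / (M - s)) ^ (k - 1) * M ^ (1 - 1 / (k : ℝ))) := by ring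
      _ ≤ E * (M * z) * ((α ^ k * 2 ^ k) * M ^ (1 - 1 / (k : ℝ))) := by gcongr
      _ = E * 2 ^ k * α ^ k * (D * z) := by rw [← hpowM]; ring
      _ ≤ _ := by gcongr
  have hcoef0 : 0 ≤ E / k * ((α * M - y) + (k - 1) * s) := by
    have : 0 ≤ ((k : ℝ) - 1) * s := mul_nonneg (by linarith) hs
    have : 0 ≤ α * M - y := sub_nonneg.2 hyN
    positivity
  calc _ ≤ E / k * ((α * M - y) + (k - 1) * s) *
        ((y / (M - s)) ^ (k - 1) * M ^ (1 - 1 / (k : ℝ))) := by gcongr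
    _ = E / k * (α * M - y) * ((y / (M - s)) ^ (k - 1) * M ^ (1 - 1 / (k : ℝ))) +
        E / k * ((k - 1) * s) * ((y / (M - s)) ^ (k - 1) * M ^ (1 - 1 / (k : ℝ))) := by ring
    _ ≤ _ := by linarith

lemma pow_mul_inv_half_rpow_pow {M : ℝ} (hM : 0 < M) (k : ℕ) (hk : 0 < k) :
    M ^ k * ((M ^ ((k : ℝ) / (k + 1)) / 2) ^ (k - 1))⁻¹ =
      2 ^ (k - 1) * M ^ (2 - 2 / ((k : ℝ) + 1)) := by
  rw [div_pow, inv_div, ← Real.rpow_natCast (M ^ ((k : ℝ) / (k + 1))), ← Real.rpow_mul hM.le,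
    ← Real.rpow_natCast M, div_eq_mul_inv, ← Real.rpow_neg hM.le, mul_left_comm,
    ← Real.rpow_add hM]
  congr 2
  rw [Nat.cast_sub hk]
  push_cast
  field_simp
  ring

end RealEstimates

/-- There is `C > 0` depending only on `h` such that whenever `|A| = m` and `|A + B| ≤ α m`,
one has `|A + hB| ≤ (e/(2h²)) α^h m^(2-1/h) + C α^h m^(2-2/(h+1))`. -/
theorem stmt_4 (h : ℕ) (hh : 0 < h) :
    ∃ C : ℝ, 0 < C ∧
      ∀ (G : Type) (_ : AddCommGroup G) (_ : DecidableEq G)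
        (A B : Finset G) (_ : A.Nonempty) (_ : B.Nonempty)
        (α : ℝ) (_ : 0 < α) (m : ℕ) (_ : A.card = m)
        (_ : ((A + B).card : ℝ) ≤ α * m),
        ((A + iterSum B h).card : ℝ) ≤
          (Real.exp 1 / (2 * (h : ℝ) ^ 2)) * α ^ h * (m : ℝ) ^ (2 - 1 / (h : ℝ))
            + C * α ^ h * (m : ℝ) ^ (2 - 2 / ((h : ℝ) + 1)) := by
  rcases Nat.lt_or_ge h 2 with h2 | h2
  · obtain rfl : h = 1 := by omega
    refine ⟨1, one_pos, fun G _ _ A B hA hB α hα m hm hAB ↦ ?_⟩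
    rw [iterSum_one]
    have hexp : (2 - 2 / (((1 : ℕ) : ℝ) + 1)) = 1 := by norm_num
    rw [hexp, Real.rpow_one, pow_one, one_mul]
    exact hAB.trans (le_add_of_nonneg_left (by positivity))
  refine ⟨3 * 2 ^ h + 2 * Real.exp 1 * 2 ^ h, by positivity,
    fun G _ _ A B hA hB α hα m hm hAB ↦ ?_⟩
  have hm1 : 1 ≤ m := hm ▸ hA.card_pos
  have hM : (1 : ℝ) ≤ m := by exact_mod_cast hm1
  have hM0 : (0 : ℝ) < m := by linarith
  have hα1 : 1 ≤ α := by
    have hle : (m : ℝ) ≤ (A + B).card := by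
      exact_mod_cast hm ▸ Finset.card_le_card_add_right hB
    refine le_of_mul_le_mul_right ?_ hM0
    linarith
  set q : ℝ := (m : ℝ) ^ ((h : ℝ) / (h + 1)) / 2 with hq
  have hq0 : 0 < q := by positivity
  obtain ⟨X, hXA, hXt, hXh⟩ :=
    exists_large_subset_card_add_iterSum_le A B h (Nat.ceil_pos.2 hq0)
  have hs : ((A \ X).card : ℝ) < q := Nat.lt_ceil.1 hXt
  have hXcard : (X.card : ℝ) = m - (A \ X).card := by
    rw [eq_sub_iff_add_eq', ← hm]
    exact_mod_cast Finset.card_sdiff_add_card_eq_card hXA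
  have hqm : q < m := by
    have : (m : ℝ) ^ ((h : ℝ) / (h + 1)) ≤ m := by
      nth_rewrite 2 [← Real.rpow_one (m : ℝ)]
      refine Real.rpow_le_rpow_of_exponent_le hM ?_
      rw [div_le_one (by positivity)]
      linarith
    linarith
  have hX : X.Nonempty := by
    rw [← Finset.card_pos]
    have : (0 : ℝ) < X.card := by linarith
    exact_mod_cast this
  have hXB : ((X + B).card : ℝ) ≤ (A + B).card := by
    exact_mod_cast Finset.card_le_card (Finset.add_subset_add_right hXA)
  have hlarge : ((X + iterSum B h).card : ℝ) ≤
      3 * 2 ^ h * α ^ h * (m : ℝ) ^ (2 - 2 / ((h : ℝ) + 1)) := by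
    calc ((X + iterSum B h).card : ℝ)
        ≤ (α * m) ^ h * (3 * ((⌈q⌉₊ : ℝ) ^ (h - 1))⁻¹) := by
          refine hXh.trans ?_
          gcongr
          exact sum_inv_max_pow_le (Nat.ceil_pos.2 hq0) h2
      _ ≤ (α * m) ^ h * (3 * (q ^ (h - 1))⁻¹) := by
          gcongr
          exact Nat.le_ceil q
      _ = 3 * α ^ h * ((m : ℝ) ^ h * (q ^ (h - 1))⁻¹) := by rw [mul_pow]; ring
      _ = 3 * 2 ^ (h - 1) * α ^ h * (m : ℝ) ^ (2 - 2 / ((h : ℝ) + 1)) := by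
          rw [hq, pow_mul_inv_half_rpow_pow hM0 h hh]; ring
      _ ≤ _ := by gcongr <;> norm_num
  have hunion := card_union_add_iterSum_le X (A \ X) B hh
  rw [Finset.union_sdiff_of_subset hXA] at hunion
  have hHle := card_iterSum_le hX B h
  rw [hXcard] at hHle
  have hexc := exceptional_part_le h2 hM hα1 (Nat.cast_nonneg _) (hXB.trans hAB)
    (Nat.cast_nonneg _) (by linarith) (Nat.cast_nonneg _) hHle
  have hmono : Real.exp 1 / h *
        (((A + B).card - (X + B).card) + (h - 1) * (A \ X).card : ℝ) *
        ((iterSum B h).card : ℝ) ^ (1 - 1 / (h : ℝ)) ≤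
      Real.exp 1 / h * ((α * m - (X + B).card) + (h - 1) * (A \ X).card) *
        ((iterSum B h).card : ℝ) ^ (1 - 1 / (h : ℝ)) := by gcongr
  linarith
end

section
/- Let $A$, $B$ be finite non-empty sets in a commutative group and let $1 \le j \le h$ be integers. Suppose that for every non-empty subset $Z \subseteq A$ one has $|A + jB| \cdot |Z| \le |Z + jB| \cdot |A|$ (i.e. the $j$-th magnification ratio of the addition graph is attained by the full set $A$). Then $|A + jB|^{h} \ge |A|^{h-j} \cdot |A + hB|^{j}$. -/
open Pointwise

section Cut

open Finset

theorem sum_eq_sum_range_card_filter_lt {α : Type*} (s : Finset α) (d : α → ℕ) (M : ℕ)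
    (hM : ∀ x ∈ s, d x ≤ M) :
    ∑ x ∈ s, d x = ∑ t ∈ range M, (s.filter fun x => t < d x).card := by
  simp_rw [card_filter]
  rw [sum_comm]
  refine sum_congr rfl fun x hx => ?_
  rw [← card_filter]
  have : (range M).filter (fun t => t < d x) = range (d x) := by
    ext t
    have := hM x hx
    simp only [mem_filter, mem_range]
    omega
  rw [this, card_range]

theorem exists_common_bound {α β : Type*} (s : Finset α) (t : Finset β) (d : α → ℕ) (e : β → ℕ) :
    ∃ M, (∀ x ∈ s, d x ≤ M) ∧ (∀ y ∈ t, e y ≤ M) ∧ 0 < M := by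
  refine ⟨s.sup d + t.sup e + 1, fun x hx => ?_, fun y hy => ?_, by omega⟩
  · have := le_sup (f := d) hx
    omega
  · have := le_sup (f := e) hy
    omega

/-- If the superlevel sets of `d` are dominated by those of `e`, so are the sums. -/
theorem mul_sum_le_of_superlevel {α β : Type*} (s : Finset α) (t : Finset β) (d : α → ℕ)
    (e : β → ℕ) (c : ℝ)
    (hle : ∀ k, c * (s.filter fun x => k < d x).card ≤ ((t.filter fun y => k < e y).card : ℝ)) :
    c * ((∑ x ∈ s, d x : ℕ) : ℝ) ≤ ((∑ y ∈ t, e y : ℕ) : ℝ) := by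
  obtain ⟨M, hs, ht, -⟩ := exists_common_bound s t d e
  rw [sum_eq_sum_range_card_filter_lt s d M hs, sum_eq_sum_range_card_filter_lt t e M ht]
  push_cast
  rw [mul_sum]
  exact sum_le_sum fun k _ => hle k

/-- If the superlevel sets of `d` are dominated by those of `e` but the sums agree, then the
supports agree as well. -/
theorem mul_card_support_le_of_superlevel {α β : Type*} (s : Finset α) (t : Finset β) (d : α → ℕ)
    (e : β → ℕ) (c : ℝ)
    (hle : ∀ k, ((s.filter fun x => k < d x).card : ℝ) ≤ c * (t.filter fun y => k < e y).card)
    (hsum : c * ((∑ y ∈ t, e y : ℕ) : ℝ) ≤ ((∑ x ∈ s, d x : ℕ) : ℝ)) :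
    c * (t.filter fun y => 0 < e y).card ≤ ((s.filter fun x => 0 < d x).card : ℝ) := by
  obtain ⟨M, hs, ht, hM⟩ := exists_common_bound s t d e
  rw [sum_eq_sum_range_card_filter_lt s d M hs, sum_eq_sum_range_card_filter_lt t e M ht] at hsum
  push_cast at hsum
  rw [mul_sum] at hsum
  by_contra! hlt
  exact absurd hsum (not_le.mpr
    (sum_lt_sum (fun k _ => hle k) ⟨0, mem_range.mpr hM, hlt⟩))

/-- The weight of a cut, a vertex in layer `i` having weight `c ^ i`. -/
def cutWeight {α : Type*} (c : ℝ) (h : ℕ) (S : ℕ → Finset α) : ℝ :=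
  ∑ i ∈ range (h + 1), c ^ i * ((S i).card : ℝ)

theorem cutWeight_sub_cutWeight {α : Type*} {c : ℝ} {h i k : ℕ} (hik : i ≠ k) (hi : i ≤ h) (hk : k ≤ h)
    {S S' : ℕ → Finset α} (hS : ∀ l, l ≠ i → l ≠ k → S' l = S l) :
    cutWeight c h S' - cutWeight c h S =
      c ^ i * ((S' i).card - (S i).card : ℝ) + c ^ k * ((S' k).card - (S k).card : ℝ) := by
  unfold cutWeight
  rw [← sum_sub_distrib]
  have hsub : ({i, k} : Finset ℕ) ⊆ range (h + 1) := by
    intro l hl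
    simp only [mem_insert, mem_singleton] at hl
    simp only [mem_range]
    omega
  rw [← sum_subset hsub, sum_pair hik]
  · ring
  · intro l _ hl
    simp only [mem_insert, mem_singleton, not_or] at hl
    rw [hS l hl.1 hl.2, sub_self]

theorem cutWeight_bot {α : Type*} (A : Finset α) (c : ℝ) (h : ℕ) :
    cutWeight c h (fun i => if i = 0 then A else ∅) = A.card := by
  unfold cutWeight
  rw [sum_eq_single 0] <;> simp +contextual

variable {G : Type*} [AddCommGroup G] [DecidableEq G]

/-- In a commutative two-step graph `P → S → N` whose steps both expand by a factor of at
least `c⁻¹`, the second step expands by exactly this factor. -/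
theorem mul_card_le_of_expansion (P S N B : Finset G) (c : ℝ) (hc : 0 < c)
    (hcomm : ∀ p ∈ P, ∀ s ∈ S, ∀ n ∈ N, s - p ∈ B → n - s ∈ B → p + (n - s) ∈ S)
    (hN : ∀ n ∈ N, ∃ s ∈ S, n - s ∈ B)
    (hdown : ∀ X ⊆ S, c * (X.card : ℝ) ≤ (P.filter fun p => ∃ s ∈ X, s - p ∈ B).card)
    (hup : ∀ X ⊆ S, (X.card : ℝ) ≤ c * (N.filter fun n => ∃ s ∈ X, n - s ∈ B).card) :
    c * (N.card : ℝ) ≤ S.card := by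
  have hout : ∀ p ∈ P, ∀ s ∈ S, s - p ∈ B →
      (N.filter fun n => n - s ∈ B).card ≤ (S.filter fun s => s - p ∈ B).card := by
    intro p hp s hs hsp
    refine card_le_card_of_injOn (fun n => p + (n - s)) (fun n hn => ?_) (fun a _ b _ h => ?_)
    · simp only [coe_filter, Set.mem_ofPred_eq] at hn ⊢
      exact ⟨hcomm p hp s hs n hn.1 hsp hn.2, by simpa using hn.2⟩
    · simpa using h
  have hin : ∀ n ∈ N, ∀ s ∈ S, n - s ∈ B →
      (P.filter fun p => s - p ∈ B).card ≤ (S.filter fun s => n - s ∈ B).card := by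
    intro n hn s hs hns
    refine card_le_card_of_injOn (fun p => p + (n - s)) (fun p hp => ?_) (fun a _ b _ h => ?_)
    · simp only [coe_filter, Set.mem_ofPred_eq] at hp ⊢
      refine ⟨hcomm p hp.1 s hs n hn hp.2 hns, ?_⟩
      convert hp.2 using 1
      abel
    · simpa using h
  have hPS : ∑ p ∈ P, (S.filter fun s => s - p ∈ B).card =
      ∑ s ∈ S, (P.filter fun p => s - p ∈ B).card :=
    sum_card_bipartiteAbove_eq_sum_card_bipartiteBelow (fun p s => s - p ∈ B)
  have hSN : ∑ s ∈ S, (N.filter fun n => n - s ∈ B).card =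
      ∑ n ∈ N, (S.filter fun s => n - s ∈ B).card :=
    sum_card_bipartiteAbove_eq_sum_card_bipartiteBelow (fun s n => n - s ∈ B)
  have hsum := mul_sum_le_of_superlevel S P (fun s => (N.filter fun n => n - s ∈ B).card)
    (fun p => (S.filter fun s => s - p ∈ B).card) c fun k => by
      refine (hdown _ (filter_subset _ _)).trans ?_
      norm_cast
      refine card_le_card fun p hp => ?_
      simp only [mem_filter] at hp ⊢
      obtain ⟨hp, s, ⟨hs, hk⟩, hsp⟩ := hp
      exact ⟨hp, hk.trans_le (hout p hp s hs hsp)⟩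
  rw [hSN, hPS] at hsum
  have key := mul_card_support_le_of_superlevel S N (fun s => (P.filter fun p => s - p ∈ B).card)
    (fun n => (S.filter fun s => n - s ∈ B).card) c (fun k => by
      refine (hup _ (filter_subset _ _)).trans (mul_le_mul_of_nonneg_left ?_ hc.le)
      norm_cast
      refine card_le_card fun n hn => ?_
      simp only [mem_filter] at hn ⊢
      obtain ⟨hn, s, ⟨hs, hk⟩, hns⟩ := hn
      exact ⟨hn, hk.trans_le (hin n hn s hs hns)⟩) hsum
  have hNeq : (N.filter fun n => 0 < (S.filter fun s => n - s ∈ B).card) = N := by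
    refine filter_true_of_mem fun n hn => ?_
    obtain ⟨s, hs, hns⟩ := hN n hn
    exact card_pos.mpr ⟨s, mem_filter.mpr ⟨hs, hns⟩⟩
  rw [hNeq] at key
  exact key.trans (by exact_mod_cast card_filter_le _ _)

/-- `S` separates the bottom layer `A` of the addition graph from its `h`-th layer, the vertices
reachable without meeting `S` lying in `R`. -/
structure IsCut (A B : Finset G) (h : ℕ) (R S : ℕ → Finset G) : Prop where
  bot : A ⊆ R 0 ∪ S 0
  step : ∀ i < h, R i + B ⊆ R (i + 1) ∪ S (i + 1)
  top : R h = ∅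

/-- Replacing part of a cut in layer `i` by its out-neighbours. -/
theorem IsCut.moveUp {A B : Finset G} {h : ℕ} {R S : ℕ → Finset G} (hcut : IsCut A B h R S)
    {i : ℕ} (hih : i < h) (X : Finset G) :
    IsCut A B h (Function.update R i (R i ∪ X))
      (Function.update (Function.update S i (S i \ X)) (i + 1)
        (S (i + 1) ∪ ((X + B) \ (R (i + 1) ∪ S (i + 1))))) := by
  have hrest : R i ∪ S i ⊆ R i ∪ X ∪ S i \ X := by
    intro x
    simp only [mem_union, mem_sdiff]
    tauto
  refine ⟨?_, fun l hl => ?_, ?_⟩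
  · rcases Nat.eq_zero_or_pos i with rfl | hi
    · simpa using hcut.bot.trans hrest
    · simpa [Function.update_of_ne hi.ne] using hcut.bot
  · rcases eq_or_ne l i with rfl | hli
    · simp only [Function.update_self, Function.update_of_ne (Nat.succ_ne_self l), union_add]
      refine union_subset ((hcut.step l hl).trans ?_) ?_
      all_goals
        intro x
        simp only [mem_union, mem_sdiff]
        tauto
    · rw [Function.update_of_ne hli, Function.update_of_ne (by omega : l + 1 ≠ i + 1)]
      rcases eq_or_ne (l + 1) i with rfl | hli'
      · simpa using (hcut.step l hl).trans hrest
      · simpa [Function.update_of_ne hli'] using hcut.step l hl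
  · rw [Function.update_of_ne hih.ne', hcut.top]

/-- Replacing part of a cut in layer `i + 1` by its in-neighbours. -/
theorem IsCut.moveDown {A B : Finset G} {h : ℕ} {R S : ℕ → Finset G} (hcut : IsCut A B h R S)
    {i : ℕ} (hih : i < h) (X : Finset G) :
    IsCut A B h (Function.update R i (R i \ ((R i).filter fun p => ∃ s ∈ X, s - p ∈ B)))
      (Function.update (Function.update S i (S i ∪ ((R i).filter fun p => ∃ s ∈ X, s - p ∈ B)))
        (i + 1) (S (i + 1) \ X)) := by
  set Q := (R i).filter fun p => ∃ s ∈ X, s - p ∈ B with hQ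
  have hrest : R i ∪ S i ⊆ R i \ Q ∪ (S i ∪ Q) := by
    intro x
    simp only [mem_union, mem_sdiff]
    tauto
  refine ⟨?_, fun l hl => ?_, ?_⟩
  · rcases Nat.eq_zero_or_pos i with rfl | hi
    · simpa using hcut.bot.trans hrest
    · simpa [Function.update_of_ne hi.ne] using hcut.bot
  · rcases eq_or_ne l i with rfl | hli
    · simp only [Function.update_self, Function.update_of_ne (Nat.succ_ne_self l)]
      intro x hx
      obtain ⟨p, hp, b, hb, rfl⟩ := mem_add.mp hx
      obtain ⟨hpR, hpQ⟩ := mem_sdiff.mp hp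
      have hmem := hcut.step l hl (add_mem_add hpR hb)
      have hX : p + b ∉ X := fun hX =>
        hpQ (mem_filter.mpr ⟨hpR, p + b, hX, by simpa using hb⟩)
      simp only [mem_union, mem_sdiff] at hmem ⊢
      tauto
    · rw [Function.update_of_ne hli, Function.update_of_ne (by omega : l + 1 ≠ i + 1)]
      rcases eq_or_ne (l + 1) i with rfl | hli'
      · simpa using (hcut.step l hl).trans hrest
      · simpa [Function.update_of_ne hli'] using hcut.step l hl
  · rw [Function.update_of_ne hih.ne', hcut.top]

/-- A cut of minimum weight can be moved up one layer at a time. -/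
theorem IsCut.weight_moveUp_le {A B : Finset G} {h : ℕ} {R S : ℕ → Finset G} {c : ℝ} (hc : 0 < c)
    (hcut : IsCut A B h R S)
    (hmin : ∀ R' S', IsCut A B h R' S' → cutWeight c h S ≤ cutWeight c h S')
    {i : ℕ} (hih : i + 1 < h) :
    c * (((S (i + 1) + B) \ (R (i + 2) ∪ S (i + 2))).card : ℝ) ≤ (S (i + 1)).card := by
  set N := (S (i + 1) + B) \ (R (i + 2) ∪ S (i + 2)) with hNdef
  refine mul_card_le_of_expansion (R i) (S (i + 1)) N B c hc ?_ ?_ ?_ ?_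
  · intro p hp s hs n hn hsp hns
    have hmem : p + (n - s) ∈ R (i + 1) ∪ S (i + 1) :=
      hcut.step i (by omega) (add_mem_add hp hns)
    refine (mem_union.mp hmem).resolve_left fun hR => (mem_sdiff.mp hn).2 ?_
    have := hcut.step (i + 1) hih (add_mem_add hR hsp)
    rwa [show p + (n - s) + (s - p) = n by abel] at this
  · intro n hn
    obtain ⟨s, hs, b, hb, rfl⟩ := mem_add.mp (mem_sdiff.mp hn).1
    exact ⟨s, hs, by simpa using hb⟩
  · intro X hX
    have hw := hmin _ _ (hcut.moveDown (i := i) (by omega) X)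
    rw [← sub_nonneg, cutWeight_sub_cutWeight (i := i) (k := i + 1) (by omega) (by omega)
      (by omega) (fun l h1 h2 => by rw [Function.update_of_ne h2, Function.update_of_ne h1])] at hw
    rw [Function.update_self, Function.update_of_ne (by omega), Function.update_self,
      card_sdiff_of_subset hX, Nat.cast_sub (card_le_card hX), pow_succ] at hw
    have hle : ((S i ∪ ((R i).filter fun p => ∃ s ∈ X, s - p ∈ B)).card : ℝ) ≤
        (S i).card + ((R i).filter fun p => ∃ s ∈ X, s - p ∈ B).card := by
      exact_mod_cast card_union_le _ _
    have hci : 0 < c ^ i := pow_pos hc i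
    refine le_of_mul_le_mul_left ?_ hci
    nlinarith [mul_le_mul_of_nonneg_left hle hci.le]
  · intro X hX
    have hw := hmin _ _ (hcut.moveUp hih X)
    rw [← sub_nonneg, cutWeight_sub_cutWeight (i := i + 1) (k := i + 2) (by omega) (by omega)
      (by omega) (fun l h1 h2 => by rw [Function.update_of_ne h2, Function.update_of_ne h1])] at hw
    rw [Function.update_self, Function.update_of_ne (by omega), Function.update_self,
      card_sdiff_of_subset hX, Nat.cast_sub (card_le_card hX), pow_succ c (i + 1)] at hw
    have hsub : (X + B) \ (R (i + 2) ∪ S (i + 2)) ⊆ N.filter fun n => ∃ s ∈ X, n - s ∈ B := by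
      intro n hn
      obtain ⟨hn, hn'⟩ := mem_sdiff.mp hn
      obtain ⟨s, hs, b, hb, rfl⟩ := mem_add.mp hn
      exact mem_filter.mpr ⟨mem_sdiff.mpr ⟨add_mem_add (hX hs) hb, hn'⟩, s, hs, by simpa using hb⟩
    have hle : ((S (i + 2) ∪ ((X + B) \ (R (i + 2) ∪ S (i + 2)))).card : ℝ) ≤
        (S (i + 2)).card + (N.filter fun n => ∃ s ∈ X, n - s ∈ B).card := by
      exact_mod_cast (card_union_le _ _).trans (Nat.add_le_add_left (card_le_card hsub) _)
    have hci : 0 < c ^ (i + 1) := pow_pos hc _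
    refine le_of_mul_le_mul_left ?_ hci
    nlinarith [mul_le_mul_of_nonneg_left hle (mul_pos hci hc).le]

/-- A cut of minimum weight can be moved out of the intermediate layers without changing its
intersection with the bottom layer. -/
theorem IsCut.exists_extremal {A B : Finset G} {h : ℕ} {R S : ℕ → Finset G} {c : ℝ} (hc : 0 < c)
    (hcut : IsCut A B h R S)
    (hmin : ∀ R' S', IsCut A B h R' S' → cutWeight c h S ≤ cutWeight c h S') :
    ∃ R' S', IsCut A B h R' S' ∧ cutWeight c h S' ≤ cutWeight c h S ∧ S' 0 = S 0 ∧
      ∀ i, 0 < i → i < h → S' i = ∅ := by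
  suffices H : ∀ k, ∃ R' S', IsCut A B h R' S' ∧ cutWeight c h S' ≤ cutWeight c h S ∧
      S' 0 = S 0 ∧ ∀ i, 0 < i → i ≤ k → i < h → S' i = ∅ by
    obtain ⟨R', S', h1, h2, h3, h4⟩ := H h
    exact ⟨R', S', h1, h2, h3, fun i hi hih => h4 i hi hih.le hih⟩
  intro k
  induction k with
  | zero => exact ⟨R, S, hcut, le_rfl, rfl, fun i hi hi' => by omega⟩
  | succ k ih =>
    obtain ⟨R', S', h1, h2, h3, h4⟩ := ih
    by_cases hk : k + 1 < h
    · have hN := h1.weight_moveUp_le hc (fun R'' S'' h'' => h2.trans (hmin R'' S'' h'')) hk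
      refine ⟨_, _, h1.moveUp hk (S' (k + 1)), ?_, ?_, fun i hi hik hih => ?_⟩
      · refine le_trans ?_ h2
        rw [← sub_nonpos, cutWeight_sub_cutWeight (i := k + 1) (k := k + 2) (by omega) (by omega)
          (by omega)
          (fun l h1 h2 => by rw [Function.update_of_ne h2, Function.update_of_ne h1])]
        rw [Function.update_self, Function.update_of_ne (by omega), Function.update_self,
          sdiff_self, pow_succ c (k + 1)]
        have hle : ((S' (k + 2) ∪ ((S' (k + 1) + B) \ (R' (k + 2) ∪ S' (k + 2)))).card : ℝ) ≤
            (S' (k + 2)).card + ((S' (k + 1) + B) \ (R' (k + 2) ∪ S' (k + 2))).card := by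
          exact_mod_cast card_union_le _ _
        have hck : 0 < c ^ (k + 1) := pow_pos hc _
        simp only [bot_eq_empty, card_empty, Nat.cast_zero]
        nlinarith [mul_le_mul_of_nonneg_left hle (mul_pos hck hc).le,
          mul_le_mul_of_nonneg_left hN hck.le]
      · rw [Function.update_of_ne (by omega), Function.update_of_ne (by omega), h3]
      · rw [Function.update_of_ne (by omega)]
        rcases eq_or_ne i (k + 1) with rfl | hne
        · simp
        · rw [Function.update_of_ne hne, h4 i hi (by omega) hih]
    · exact ⟨R', S', h1, h2, h3, fun i hi _ hih => h4 i hi (by omega) hih⟩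

/-- The cut consisting of the whole bottom layer. -/
theorem isCut_bot (A B : Finset G) (h : ℕ) :
    IsCut A B h (fun _ => ∅) (fun i => if i = 0 then A else ∅) :=
  ⟨by simp, by simp, rfl⟩

theorem exists_min_cut (A B : Finset G) (h : ℕ) {c : ℝ} (hc : 0 < c) :
    ∃ R S, IsCut A B h R S ∧
      ∀ R' S', IsCut A B h R' S' → cutWeight c h S ≤ cutWeight c h S' := by
  let W : (Fin (h + 1) → ℕ) → ℝ := fun n => ∑ i : Fin (h + 1), c ^ (i : ℕ) * (n i : ℝ)
  have hW : ∀ S : ℕ → Finset G, W (fun i => (S i).card) = cutWeight c h S := fun S =>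
    Fin.sum_univ_eq_sum_range (fun i => c ^ i * ((S i).card : ℝ)) (h + 1)
  have hmono : Monotone W := fun m n hmn =>
    sum_le_sum fun i _ => mul_le_mul_of_nonneg_left (by exact_mod_cast hmn i) (by positivity)
  let T : Set (Fin (h + 1) → ℕ) := {n | ∃ R S, IsCut A B h R S ∧ n = fun i : Fin (h + 1) => (S i).card}
  have hwf : (W '' T).IsWF := ((Set.isPWO_of_wellQuasiOrderedLE T).image_of_monotone hmono).isWF
  have hne : (W '' T).Nonempty := ⟨_, _, ⟨_, _, isCut_bot A B h, rfl⟩, rfl⟩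
  obtain ⟨n, ⟨R, S, hcut, rfl⟩, hn⟩ := hwf.min_mem hne
  refine ⟨R, S, hcut, fun R' S' h' => ?_⟩
  rw [← hW S, ← hW S', hn]
  exact hwf.min_le hne ⟨_, ⟨R', S', h', rfl⟩, rfl⟩

theorem add_iterSum_zero (A B : Finset G) : A + iterSum B 0 = A := by
  rw [iterSum, singleton_zero, add_zero]

theorem add_iterSum_succ (A B : Finset G) (k : ℕ) :
    A + iterSum B (k + 1) = A + iterSum B k + B := by
  simp [iterSum, add_assoc]

/-- For a cut avoiding the intermediate layers, what is not cut at the bottom is cut at the top. -/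
theorem IsCut.add_iterSum_subset {A B : Finset G} {h : ℕ} {R S : ℕ → Finset G}
    (hcut : IsCut A B h R S) (hh : 0 < h) (hS : ∀ i, 0 < i → i < h → S i = ∅) :
    (A \ S 0) + iterSum B h ⊆ S h := by
  have hR : ∀ i < h, (A \ S 0) + iterSum B i ⊆ R i := by
    intro i
    induction i with
    | zero =>
      intro _ x hx
      rw [add_iterSum_zero, mem_sdiff] at hx
      exact (mem_union.mp (hcut.bot hx.1)).resolve_right hx.2
    | succ i ih =>
      intro hi
      rw [add_iterSum_succ]
      refine (add_subset_add_right (ih (by omega))).trans ((hcut.step i (by omega)).trans ?_)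
      rw [hS (i + 1) (by omega) hi, union_empty]
  obtain ⟨k, rfl⟩ := Nat.exists_eq_add_of_lt hh
  rw [zero_add] at *
  rw [add_iterSum_succ]
  refine (add_subset_add_right (hR k (by omega))).trans ((hcut.step k (by omega)).trans ?_)
  rw [hcut.top, empty_union]

/-- If `Z + hB` is cut at the top, cutting everything else in layer `j` yields a cut. -/
theorem isCut_of_layer {A B Z T : Finset G} {j h : ℕ} (hj : 0 < j) (hjh : j < h)
    (hT : Z + iterSum B h ⊆ T) :
    IsCut A B h
      (fun i => if i < j then A + iterSum B i else if i < h then Z + iterSum B i else ∅)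
      (fun i => if i = j then (A + iterSum B j) \ (Z + iterSum B j) else if i = h then T else ∅) :=
    by
  refine ⟨?_, fun i hi => ?_, ?_⟩
  · simp [hj, add_iterSum_zero]
  · rcases lt_trichotomy (i + 1) j with h1 | h1 | h1
    · simp [h1, (by omega : i < j), add_iterSum_succ]
    · subst h1
      simp only [lt_add_iff_pos_right, zero_lt_one, if_true, lt_irrefl, if_false, hjh]
      rw [← add_iterSum_succ]
      intro x hx
      simp only [mem_union, mem_sdiff]
      tauto
    · have hij : ¬ i < j := by omega
      have hij' : ¬ i + 1 < j := by omega
      simp only [hij, hij', hi, h1.ne', if_true, if_false]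
      rw [← add_iterSum_succ]
      rcases eq_or_ne (i + 1) h with rfl | h2
      · simpa using hT
      · have hlt : i + 1 < h := by omega
        simp [hlt, h2]
  · rw [if_neg (by omega), if_neg (lt_irrefl h)]

/-- The strengthened Plünnecke inequality in normalised form. -/
theorem pow_mul_card_add_iterSum_le {A B : Finset G} {j h : ℕ} (hj : 0 < j) (hjh : j < h) {c : ℝ}
    (hc : 0 < c) (hA : c ^ j * ((A + iterSum B j).card : ℝ) ≤ A.card)
    (hZ : ∀ Z ⊆ A, (Z.card : ℝ) ≤ c ^ j * (Z + iterSum B j).card) :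
    c ^ h * ((A + iterSum B h).card : ℝ) ≤ A.card := by
  obtain ⟨R₀, S₀, hcut₀, hmin₀⟩ := exists_min_cut A B h hc
  obtain ⟨R, S, hcut, hle, -, hS⟩ := hcut₀.exists_extremal hc hmin₀
  have hmin : ∀ R' S', IsCut A B h R' S' → cutWeight c h S ≤ cutWeight c h S' :=
    fun R' S' h' => hle.trans (hmin₀ R' S' h')
  have hlayer := isCut_of_layer (A := A) hj hjh (hcut.add_iterSum_subset (by omega) hS)
  set Z := A \ S 0 with hZdef
  set T : ℕ → Finset G := fun i =>
    if i = j then (A + iterSum B j) \ (Z + iterSum B j) else if i = h then S h else ∅ with hTdef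
  have hT0 : T 0 = ∅ := by
    simp only [hTdef]
    rw [if_neg hj.ne, if_neg (by omega)]
  have hwT : cutWeight c h T ≤ cutWeight c h S := by
    have hZA : Z ⊆ A := sdiff_subset
    have hsub : Z + iterSum B j ⊆ A + iterSum B j := add_subset_add_right hZA
    have h1 : cutWeight c h T =
        c ^ j * ((A + iterSum B j).card - (Z + iterSum B j).card) + c ^ h * (S h).card := by
      unfold cutWeight
      rw [← sum_subset (s₁ := {j, h}), sum_pair hjh.ne]
      · simp [hTdef, hjh.ne', card_sdiff_of_subset hsub, Nat.cast_sub (card_le_card hsub)]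
      · intro l hl
        simp only [mem_insert, mem_singleton] at hl
        simp only [mem_range]
        omega
      · intro l _ hl
        simp only [mem_insert, mem_singleton, not_or] at hl
        simp [hTdef, hl.1, hl.2]
    have h2 : (S 0).card + c ^ h * (S h).card ≤ cutWeight c h S := by
      unfold cutWeight
      refine le_trans (le_of_eq ?_) (sum_le_sum_of_subset_of_nonneg (s := {0, h}) ?_ ?_)
      · rw [sum_pair (by omega)]
        simp
      · intro l hl
        simp only [mem_insert, mem_singleton] at hl
        simp only [mem_range]
        omega
      · intros
        positivity
    have h3 : (A.card : ℝ) ≤ Z.card + (S 0).card := by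
      exact_mod_cast (card_le_card (by simp [hZdef] : A ⊆ Z ∪ S 0)).trans (card_union_le _ _)
    have h4 := hZ Z hZA
    linarith
  obtain ⟨R', S', hcut', hle', hS0, hS'⟩ :=
    hlayer.exists_extremal hc fun R' S' h' => hwT.trans (hmin R' S' h')
  have htop := hcut'.add_iterSum_subset (by omega) hS'
  rw [hS0, hT0, sdiff_empty] at htop
  have hbot := hmin _ _ (isCut_bot A B h)
  rw [cutWeight_bot] at hbot
  calc c ^ h * ((A + iterSum B h).card : ℝ) ≤ c ^ h * (S' h).card :=
        mul_le_mul_of_nonneg_left (by exact_mod_cast card_le_card htop) (by positivity)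
    _ ≤ cutWeight c h S' :=
        single_le_sum (f := fun i => c ^ i * ((S' i).card : ℝ)) (fun i _ => by positivity)
          (mem_range.mpr (Nat.lt_succ_self h))
    _ ≤ A.card := hle'.trans (hwT.trans hbot)

theorem iterSum_nonempty {B : Finset G} (hB : B.Nonempty) (k : ℕ) : (iterSum B k).Nonempty := by
  induction k with
  | zero => exact singleton_nonempty 0
  | succ k ih => exact ih.add hB

end Cut

/-- Strengthened Plünnecke inequality on addition graphs: if the `j`-th magnification
ratio is attained by the full set `A`, then `|A + jB|^h ≥ |A|^(h-j) |A + hB|^j`. -/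
theorem stmt_7 {G : Type*} [AddCommGroup G] [DecidableEq G]
    (A B : Finset G) (hA : A.Nonempty) (hB : B.Nonempty)
    (j h : ℕ) (hj : 1 ≤ j) (hjh : j ≤ h)
    (hmin : ∀ Z ⊆ A, Z.Nonempty →
      (A + iterSum B j).card * Z.card ≤ (Z + iterSum B j).card * A.card) :
    A.card ^ (h - j) * (A + iterSum B h).card ^ j ≤ (A + iterSum B j).card ^ h := by
  rcases hjh.eq_or_lt with rfl | hlt
  · simp
  have ha : (0 : ℝ) < A.card := by exact_mod_cast hA.card_pos
  have hv : (0 : ℝ) < (A + iterSum B j).card := by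
    exact_mod_cast (hA.add (iterSum_nonempty hB j)).card_pos
  set a : ℝ := (A.card : ℝ) with ha_def
  set v : ℝ := ((A + iterSum B j).card : ℝ) with hv_def
  set c : ℝ := (a / v) ^ ((j : ℝ)⁻¹) with hcdef
  have hc : 0 < c := Real.rpow_pos_of_pos (div_pos ha hv) _
  have hcj : c ^ j = a / v := Real.rpow_inv_natCast_pow (div_pos ha hv).le (by omega)
  have key := pow_mul_card_add_iterSum_le (A := A) (B := B) hj hlt hc
    (by rw [hcj, div_mul_cancel₀ _ hv.ne']) fun Z hZA => by
      rcases Z.eq_empty_or_nonempty with rfl | hZ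
      · simp
      · rw [hcj, div_mul_eq_mul_div, le_div_iff₀ hv]
        have := hmin Z hZA hZ
        have hr : v * Z.card ≤ (Z + iterSum B j).card * a := by
          rw [hv_def, ha_def]
          exact_mod_cast this
        linarith
  have hpow := pow_le_pow_left₀ (by positivity) key j
  rw [mul_pow, ← pow_mul, mul_comm h j, pow_mul, hcj, div_pow, div_mul_eq_mul_div,
    div_le_iff₀ (by positivity)] at hpow
  have hsplit : a ^ h = a ^ j * a ^ (h - j) := by rw [← pow_add, Nat.add_sub_cancel' hjh]
  rw [hsplit, mul_assoc] at hpow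
  have hfin : a ^ (h - j) * ((A + iterSum B h).card : ℝ) ^ j ≤ v ^ h :=
    le_of_mul_le_mul_left (hpow.trans_eq (by ring)) (pow_pos ha j)
  rw [ha_def, hv_def] at hfin
  exact_mod_cast hfin
end

section
/- Let $B$ be a finite non-empty set in a commutative group, $h$ a positive integer, and $X$ a finite non-empty set such that for every non-empty subset $Z \subseteq X$ one has $|X + B| \cdot |Z| \le |Z + B| \cdot |X|$. Then $|X + hB| \le \left\lfloor \frac{|X+B|^h}{|X|^{h-1}} \right\rfloor$; in particular $|X + hB| \cdot |X|^{h-1} \le |X+B|^h$. -/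
open Pointwise

/-- Plünnecke's inequality for iterated sumsets, when `X` minimises the magnification ratio. -/
theorem card_add_iterSum_mul_pow_le {G : Type*} [AddCommGroup G] [DecidableEq G]
    {X B : Finset G} (hmin : ∀ Z ⊆ X, (X + B).card * Z.card ≤ (Z + B).card * X.card) (n : ℕ) :
    (X + iterSum B (n + 1)).card * X.card ^ n ≤ (X + B).card ^ (n + 1) := by
  induction n with
  | zero => simp [iterSum, Finset.singleton_zero]
  | succ n ih =>
    have hstep := Finset.pluennecke_petridis_inequality_add (iterSum B (n + 1)) hmin
    have heq : X + iterSum B (n + 2) = iterSum B (n + 1) + X + B := by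
      rw [iterSum, add_left_comm, add_assoc]
    calc
      (X + iterSum B (n + 2)).card * X.card ^ (n + 1)
        = (iterSum B (n + 1) + X + B).card * X.card * X.card ^ n := by rw [heq]; ring
      _ ≤ (X + B).card * (iterSum B (n + 1) + X).card * X.card ^ n := by gcongr
      _ = (X + B).card * ((X + iterSum B (n + 1)).card * X.card ^ n) := by
        rw [add_comm X (iterSum B (n + 1)), mul_assoc]
      _ ≤ (X + B).card * (X + B).card ^ (n + 1) := by gcongr
      _ = (X + B).card ^ (n + 2) := by ring

/-- If the first magnification ratio of the addition graph is attained by the full set `X`,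
then `|X + hB| ≤ ⌊|X + B|^h / |X|^(h-1)⌋`; in particular
`|X + hB| · |X|^(h-1) ≤ |X + B|^h`. -/
theorem stmt_8 {G : Type*} [AddCommGroup G] [DecidableEq G]
    (X B : Finset G) (hX : X.Nonempty) (hB : B.Nonempty)
    (h : ℕ) (hh : 0 < h)
    (hmin : ∀ Z ⊆ X, Z.Nonempty → (X + B).card * Z.card ≤ (Z + B).card * X.card) :
    (X + iterSum B h).card ≤ (X + B).card ^ h / X.card ^ (h - 1) ∧
      (X + iterSum B h).card * X.card ^ (h - 1) ≤ (X + B).card ^ h := by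
  obtain ⟨n, rfl⟩ := Nat.exists_eq_add_one.mpr hh
  have hmul : (X + iterSum B (n + 1)).card * X.card ^ n ≤ (X + B).card ^ (n + 1) := by
    refine card_add_iterSum_mul_pow_le (fun Z hZ => ?_) n
    obtain rfl | hne := Z.eq_empty_or_nonempty
    · simp
    · exact hmin Z hZ hne
  exact ⟨(Nat.le_div_iff_mul_le (pow_pos hX.card_pos n)).mpr hmul, hmul⟩
end

section
/- Let $A$, $B$, $C$ be finite sets in a commutative group with $A$, $B$ non-empty, and let $h$ be a positive integer. Let $\beta$ be the unique positive real satisfying $\prod_{r=0}^{h-1}(\beta + r) = h! \cdot |hB|$ (i.e. $\binom{\beta + h - 1}{h} = |hB|$ as a generalized binomial coefficient). Then $|(A + hB) \setminus (C + (h-1)B)| \le \frac{|(A+B) \setminus C| \cdot |hB|}{\beta}$. -/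
open Pointwise

theorem card_union_sdiff_eq_add {α : Type*} [DecidableEq α] (X Y Z : Finset α) :
    ((X ∪ Y) \ Z).card = (Y \ Z).card + (X \ (Z ∪ Y)).card := by
  rw [← Finset.card_union_of_disjoint]
  · congr 1
    ext
    grind
  · rw [Finset.disjoint_left]
    grind

section

variable {G : Type*} [AddCommGroup G] [DecidableEq G]

theorem mem_iterSum {B : Finset G} {k : ℕ} {x : G} :
    x ∈ iterSum B k ↔ ∃ s : Multiset G, s.card = k ∧ (∀ b ∈ s, b ∈ B) ∧ s.sum = x := by
  induction k generalizing x with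
  | zero =>
    simp only [iterSum, Finset.mem_singleton, Multiset.card_eq_zero]
    constructor
    · rintro rfl
      exact ⟨0, by simp⟩
    · rintro ⟨s, rfl, -, rfl⟩
      simp
  | succ k ih =>
    simp only [iterSum, Finset.mem_add, ih]
    constructor
    · rintro ⟨_, ⟨s, hs, hsB, rfl⟩, b, hb, rfl⟩
      refine ⟨b ::ₘ s, by simp [hs], ?_, by simp [add_comm]⟩
      simpa using ⟨hb, hsB⟩
    · rintro ⟨s, hs, hsB, rfl⟩
      obtain ⟨b, t, rfl⟩ := Multiset.card_pos_iff_exists_mem.1 (by omega : 0 < s.card) |>.imp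
        fun _ hb ↦ Multiset.exists_cons_of_mem hb
      simp only [Multiset.card_cons, Nat.add_right_cancel_iff, Multiset.mem_cons,
        forall_eq_or_imp] at hs hsB
      exact ⟨t.sum, ⟨t, hs, hsB.2, rfl⟩, b, hsB.1, by simp [add_comm]⟩

theorem card_iterSum_le_multichoose (B : Finset G) (k : ℕ) :
    (iterSum B k).card ≤ B.card.multichoose k := by
  rw [← Fintype.card_coe B, ← Sym.card_sym_eq_multichoose, ← Finset.card_univ]
  refine (Finset.card_le_card fun x hx ↦ ?_).trans (Finset.card_image_le
    (f := fun s : Sym B k ↦ ((s : Multiset B).map Subtype.val).sum))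
  obtain ⟨s, hs, hsB, rfl⟩ := mem_iterSum.1 hx
  refine Finset.mem_image.2 ⟨⟨s.attach.map fun b : {b // b ∈ s} ↦ ⟨b.1, hsB b.1 b.2⟩, by simpa using hs⟩,
    Finset.mem_univ _, ?_⟩
  simp [Multiset.map_map]

theorem factorial_mul_card_iterSum_le (B : Finset G) (k : ℕ) :
    (k.factorial : ℝ) * (iterSum B k).card ≤ ∏ r ∈ Finset.range k, ((B.card : ℝ) + r) := by
  have h : k.factorial * (iterSum B k).card ≤ ∏ r ∈ Finset.range k, (B.card + r) := by
    rw [← Nat.ascFactorial_eq_prod_range, Nat.ascFactorial_eq_factorial_mul_choose',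
      ← Nat.multichoose_eq]
    exact Nat.mul_le_mul_left _ (card_iterSum_le_multichoose B k)
  exact_mod_cast h

theorem iterSum_succ' (B : Finset G) (k : ℕ) : iterSum B (k + 1) = B + iterSum B k :=
  add_comm _ _

theorem card_iterSum_mul_le {B T : Finset G} {k : ℕ} {β : ℝ} (hβpos : 0 < β)
    (hβ : ∏ r ∈ Finset.range (k + 1), (β + r) =
      ((k + 1).factorial : ℝ) * (iterSum B (k + 1)).card)
    (hT : (T.card : ℝ) ≤ β) :
    ((iterSum T (k + 1)).card : ℝ) * β ≤ T.card * (iterSum B (k + 1)).card := by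
  have hfac : (0 : ℝ) < (k + 1).factorial := by positivity
  refine le_of_mul_le_mul_left ?_ hfac
  calc ((k + 1).factorial : ℝ) * ((iterSum T (k + 1)).card * β)
      = ((k + 1).factorial * (iterSum T (k + 1)).card) * β := by ring
    _ ≤ (∏ r ∈ Finset.range (k + 1), ((T.card : ℝ) + r)) * β := by
      gcongr
      exact factorial_mul_card_iterSum_le T (k + 1)
    _ = T.card * ((∏ r ∈ Finset.range k, ((T.card : ℝ) + (r + 1 : ℕ))) * β) := by
      rw [Finset.prod_range_succ']
      push_cast
      ring
    _ ≤ T.card * ((∏ r ∈ Finset.range k, (β + (r + 1 : ℕ))) * β) := by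
      gcongr
    _ = T.card * ∏ r ∈ Finset.range (k + 1), (β + r) := by
      rw [Finset.prod_range_succ' _ k]
      push_cast
      ring
    _ = (k + 1).factorial * (T.card * (iterSum B (k + 1)).card) := by
      rw [hβ]
      ring

theorem singleton_add_iterSum_sdiff_subset (a : G) (B C : Finset G) (k : ℕ) :
    ({a} + iterSum B (k + 1)) \ (C + iterSum B k) ⊆
      {a} + iterSum {b ∈ B | a + b ∉ C} (k + 1) := by
  intro x hx
  obtain ⟨hx, hxC⟩ := Finset.mem_sdiff.1 hx
  obtain ⟨_, ha, y, hy, rfl⟩ := Finset.mem_add.1 hx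
  obtain rfl := Finset.mem_singleton.1 ha
  obtain ⟨s, hs, hsB, rfl⟩ := mem_iterSum.1 hy
  refine Finset.add_mem_add ha (mem_iterSum.2 ⟨s, hs, fun b hb ↦ ?_, rfl⟩)
  refine Finset.mem_filter.2 ⟨hsB b hb, fun hbC ↦ hxC ?_⟩
  obtain ⟨t, rfl⟩ := Multiset.exists_cons_of_mem hb
  rw [Multiset.sum_cons, ← add_assoc]
  exact Finset.add_mem_add hbC (mem_iterSum.2
    ⟨t, by simpa using hs, fun c hc ↦ hsB c (Multiset.mem_cons_of_mem hc), rfl⟩)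

theorem card_singleton_add_sdiff (a : G) (B C : Finset G) :
    (({a} + B) \ C).card = {b ∈ B | a + b ∉ C}.card := by
  rw [← Finset.card_image_of_injective (Finset.filter _ _) (add_right_injective a)]
  congr 1
  ext x
  simp only [Finset.singleton_add, Finset.mem_sdiff, Finset.mem_vadd_finset, vadd_eq_add,
    Finset.mem_image, Finset.mem_filter]
  grind

theorem card_singleton_layer_mul_le {B : Finset G} {k : ℕ} {β : ℝ} (hβpos : 0 < β)
    (hβ : ∏ r ∈ Finset.range (k + 1), (β + r) =
      ((k + 1).factorial : ℝ) * (iterSum B (k + 1)).card) (a : G) (C : Finset G) :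
    ((({a} + iterSum B (k + 1)) \ (C + iterSum B k)).card : ℝ) * β ≤
      (({a} + B) \ C).card * (iterSum B (k + 1)).card := by
  rw [card_singleton_add_sdiff a B C]
  rcases le_total (({b ∈ B | a + b ∉ C}.card : ℝ)) β with hT | hT
  · refine le_trans ?_ (card_iterSum_mul_le hβpos hβ hT)
    gcongr ?_ * β
    exact_mod_cast (Finset.card_le_card (singleton_add_iterSum_sdiff_subset a B C k)).trans_eq
      (Finset.card_singleton_add _ _)
  · rw [mul_comm]
    refine mul_le_mul hT ?_ (by positivity) (by positivity)
    exact_mod_cast (Finset.card_le_card Finset.sdiff_subset).trans_eq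
      (Finset.card_singleton_add _ _)

theorem card_layer_mul_le {B : Finset G} {k : ℕ} {β : ℝ} (hβpos : 0 < β)
    (hβ : ∏ r ∈ Finset.range (k + 1), (β + r) =
      ((k + 1).factorial : ℝ) * (iterSum B (k + 1)).card) (A C : Finset G) :
    (((A + iterSum B (k + 1)) \ (C + iterSum B k)).card : ℝ) * β ≤
      ((A + B) \ C).card * (iterSum B (k + 1)).card := by
  induction A using Finset.induction_on with
  | empty => simp
  | insert a A _ ih =>
    have hsing := card_singleton_layer_mul_le hβpos hβ a (C ∪ (A + B))
    rw [Finset.union_add, add_assoc, ← iterSum_succ'] at hsing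
    rw [Finset.insert_eq, Finset.union_add, Finset.union_add, card_union_sdiff_eq_add,
      card_union_sdiff_eq_add]
    push_cast
    linarith

end

/-- Growth of restricted addition graphs: with `β` the pseudo-cardinality of `B`,
i.e. `∏_{r=0}^{h-1} (β + r) = h! |hB|`, we have
`|(A + hB) \ (C + (h-1)B)| ≤ |(A+B) \ C| · |hB| / β`. -/
theorem stmt_11 {G : Type*} [AddCommGroup G] [DecidableEq G]
    (A B C : Finset G) (hA : A.Nonempty) (hB : B.Nonempty)
    (h : ℕ) (hh : 0 < h) (β : ℝ) (hβpos : 0 < β)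
    (hβ : ∏ r ∈ Finset.range h, (β + r) = (Nat.factorial h : ℝ) * ((iterSum B h).card : ℝ)) :
    (((A + iterSum B h) \ (C + iterSum B (h - 1))).card : ℝ) ≤
      (((A + B) \ C).card : ℝ) * ((iterSum B h).card : ℝ) / β := by
  obtain ⟨k, rfl⟩ := Nat.exists_eq_succ_of_ne_zero hh.ne'
  rw [le_div_iff₀ hβpos]
  exact card_layer_mul_le hβpos hβ A C
end
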